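/- arXiv:1803.02807 — 3 statements merged into one kernel-verified Lean document; each statement's English description precedes it below -/
import Mathlib

section
/- Let Σ = {c_0, c_1, …, c_{σ−1}} be an alphabet of size σ, let m > 1 be an integer, and let h : Σ → ℕ be the mapping h(c_i) = m^i for i = 0, …, σ−1. Then for any two distinct k-multicombinations (k-combinations with repetitions) φ₁ and φ₂ from Σ, with 1 ≤ k ≤ m, the sums of heap values differ: Σ_{c∈φ₁} h(c) ≠ Σ_{c∈φ₂} h(c). Formally: if φ₁ and φ₂ are multisets of elements of Fin σ with card φ₁ = card φ₂ = k, 1 ≤ k ≤ m, and φ₁ ≠ φ₂, then Σ_{i∈φ₁} m^i ≠ Σ_{i∈φ₂} m^i. -/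
theorem heap_aux_head (m n : ℕ) (hm : 1 < m) (c0 d0 : ℕ) (c d : Fin n → ℕ)
    (hs : c0 + ∑ i, c i = d0 + ∑ i, d i) (hle : c0 + ∑ i, c i ≤ m)
    (hv : c0 + m * ∑ i, c i * m ^ (i : ℕ) = d0 + m * ∑ i, d i * m ^ (i : ℕ)) :
    ¬ c0 < d0 := by
  intro hlt
  have hC : ∑ i, c i ≤ ∑ i, c i * m ^ (i : ℕ) :=
    Finset.sum_le_sum fun i _ => Nat.le_mul_of_pos_right _ (by positivity)
  have hD : ∑ i, d i = 0 → ∑ i, d i * m ^ (i : ℕ) = 0 := by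
    intro h
    rw [Finset.sum_eq_zero_iff] at h
    exact Finset.sum_eq_zero fun i hi => by rw [h i hi, zero_mul]
  generalize ∑ i, c i * m ^ (i : ℕ) = C at *
  generalize ∑ i, d i * m ^ (i : ℕ) = D at *
  have hDC : D < C := by
    by_contra hcon
    have := Nat.mul_le_mul_left m (not_lt.mp hcon)
    omega
  have h1 := Nat.mul_le_mul_left m (Nat.succ_le_of_lt hDC)
  rw [Nat.succ_eq_add_one, mul_add, mul_one] at h1
  have h0 : D = 0 := hD (by omega)
  subst h0
  have h2 := Nat.mul_le_mul_left m (show 2 ≤ C by omega)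
  omega

theorem heap_aux (m : ℕ) (hm : 1 < m) : ∀ (n : ℕ) (c d : Fin n → ℕ),
    ∑ i, c i = ∑ i, d i → ∑ i, c i ≤ m →
    ∑ i, c i * m ^ (i : ℕ) = ∑ i, d i * m ^ (i : ℕ) → c = d := by
  intro n
  induction n with
  | zero => intro c d _ _ _; exact Subsingleton.elim _ _
  | succ n ih =>
    intro c d hs hle hv
    have key : ∀ e : Fin (n + 1) → ℕ, ∑ i, e i * m ^ (i : ℕ)
        = e 0 + m * ∑ i : Fin n, e i.succ * m ^ (i : ℕ) := by
      intro e
      rw [Fin.sum_univ_succ, Finset.mul_sum]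
      simp only [Fin.val_zero, pow_zero, mul_one, Fin.val_succ]
      congr 1
      exact Finset.sum_congr rfl fun i _ => by ring
    rw [key, key] at hv
    rw [Fin.sum_univ_succ] at hle
    rw [Fin.sum_univ_succ, Fin.sum_univ_succ] at hs
    have a1 := heap_aux_head m n hm _ _ (fun i => c i.succ) (fun i => d i.succ) hs hle hv
    have a2 := heap_aux_head m n hm _ _ (fun i => d i.succ) (fun i => c i.succ) hs.symm
      (hs ▸ hle) hv.symm
    have h0 : c 0 = d 0 := by omega
    rw [h0] at hv hs
    have ht := ih (fun i => c i.succ) (fun i => d i.succ) (by omega) (by omega)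
      (Nat.eq_of_mul_eq_mul_left (by omega : 0 < m) (Nat.add_left_cancel hv))
    funext i
    refine Fin.cases h0 (fun j => congrFun ht j) i


/-- Lemma 1 (Heap-Counting): for an alphabet `Fin σ`, an integer `m > 1`, and the
heap function `h i = m ^ i`, any two distinct `k`-multicombinations (multisets of
cardinality `k`) from the alphabet, with `1 ≤ k ≤ m`, have different heap values. -/
theorem heap_values_of_distinct_multicombinations_differ
    (σ m k : ℕ) (hm : 1 < m) (hk1 : 1 ≤ k) (hkm : k ≤ m)
    (φ₁ φ₂ : Multiset (Fin σ))
    (h1 : Multiset.card φ₁ = k) (h2 : Multiset.card φ₂ = k)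
    (hne : φ₁ ≠ φ₂) :
    (φ₁.map (fun i => m ^ (i : ℕ))).sum ≠ (φ₂.map (fun i => m ^ (i : ℕ))).sum := by
  intro hv
  apply hne
  have hsum : ∀ φ : Multiset (Fin σ), (φ.map (fun i : Fin σ => m ^ (i : ℕ))).sum
      = ∑ i : Fin σ, φ.count i * m ^ (i : ℕ) := by
    intro φ
    rw [Finset.sum_multiset_map_count]
    simp only [smul_eq_mul]
    apply Finset.sum_subset (Finset.subset_univ φ.toFinset)
    intro i _ hi
    rw [Multiset.count_eq_zero_of_notMem (by simpa using hi), zero_mul]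
  have hcard : ∀ φ : Multiset (Fin σ), ∑ i : Fin σ, φ.count i = Multiset.card φ := by
    intro φ
    exact Multiset.sum_count_eq_card (fun i _ => Finset.mem_univ (α := Fin σ) i)
  -- the frozen statement coerces `φ` to a multiset of naturals through the multiset monad
  simp only [Multiset.bind_def, Multiset.pure_def, Multiset.bind_singleton, Multiset.map_map,
    Function.comp_def] at hv
  rw [hsum, hsum] at hv
  have := heap_aux m hm σ (fun i => φ₁.count i) (fun i => φ₂.count i)
    (by rw [hcard, hcard, h1, h2]) (by rw [hcard, h1]; exact hkm) hv
  exact Multiset.ext.mpr fun i => congrFun this i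
end

section
/- Let σ be a positive integer and let m > 1 be an integer. For any two strings w₁ and w₂ over the alphabet Fin σ, both of length k with 1 ≤ k ≤ m (modeled as lists over Fin σ of length k), the heap values coincide, i.e. Σ_{i=0}^{k−1} m^{w₁[i]} = Σ_{i=0}^{k−1} m^{w₂[i]}, if and only if w₂ is a permutation of w₁ (equivalently, w₁ and w₂ determine the same multiset of characters). -/
lemma heap_aux_lt (m c0 d0 C D S T : ℕ) (hm : 1 < m) (hS : S ≤ C)
    (hT : T = 0 → D = 0) (hle : c0 + S ≤ m)
    (hs : c0 + S = d0 + T) (hw : c0 + m * C = d0 + m * D) : ¬ c0 < d0 := by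
  intro hlt
  have hDC : D < C := by
    by_contra hcon
    have := Nat.mul_le_mul_left m (not_lt.mp hcon)
    omega
  have h1 : m * (D + 1) ≤ m * C := Nat.mul_le_mul_left m hDC
  rw [mul_add, mul_one] at h1
  have hD : D = 0 := hT (by omega)
  subst hD
  have h2 : C = 1 := by
    have : m * C = m * 1 := by omega
    exact Nat.eq_of_mul_eq_mul_left (by omega) this
  omega

lemma heap_tail (m n : ℕ) (hm : 1 < m) (c : Fin n → ℕ) :
    ∑ i, c i ≤ ∑ i, c i * m ^ (i : ℕ) ∧
      (∑ i, c i = 0 → ∑ i, c i * m ^ (i : ℕ) = 0) := by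
  constructor
  · apply Finset.sum_le_sum
    intro i _
    exact Nat.le_mul_of_pos_right _ (pow_pos (by omega) _)
  · intro h
    rw [Finset.sum_eq_zero_iff] at h
    apply Finset.sum_eq_zero
    intro i hi
    rw [h i hi, zero_mul]

lemma heap_counts (m : ℕ) (hm : 1 < m) : ∀ (n : ℕ) (c d : Fin n → ℕ),
    ∑ i, c i ≤ m → ∑ i, c i = ∑ i, d i →
    ∑ i, c i * m ^ (i : ℕ) = ∑ i, d i * m ^ (i : ℕ) → c = d := by
  intro n
  induction n with
  | zero => intro c d _ _ _; exact Subsingleton.elim _ _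
  | succ n ih =>
    intro c d hle hs hw
    have key : ∀ e : Fin (n + 1) → ℕ, ∑ i, e i * m ^ (i : ℕ)
        = e 0 + m * ∑ i : Fin n, e i.succ * m ^ (i : ℕ) := by
      intro e
      rw [Fin.sum_univ_succ, Finset.mul_sum]
      simp only [Fin.val_zero, pow_zero, mul_one, Fin.val_succ, pow_succ]
      congr 1
      apply Finset.sum_congr rfl
      intro i _
      ring
    rw [key, key] at hw
    rw [Fin.sum_univ_succ] at hle
    rw [Fin.sum_univ_succ, Fin.sum_univ_succ] at hs
    obtain ⟨a1, a2⟩ := heap_tail m n hm (fun i => c i.succ)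
    obtain ⟨b1, b2⟩ := heap_tail m n hm (fun i => d i.succ)
    have n1 := heap_aux_lt m _ _ _ _ _ _ hm a1 b2 hle hs hw
    have n2 := heap_aux_lt m _ _ _ _ _ _ hm b1 a2 (hs ▸ hle) hs.symm hw.symm
    have h0 : c 0 = d 0 := by omega
    have ht := ih (fun i => c i.succ) (fun i => d i.succ) (by omega) (by omega)
      (Nat.eq_of_mul_eq_mul_left (by omega : 0 < m) (by omega))
    funext i
    refine Fin.cases h0 (fun j => congrFun ht j) i

lemma heap_sum_count (σ : ℕ) (f : Fin σ → ℕ) (w : List (Fin σ)) :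
    (w.map f).sum = ∑ i, w.count i * f i := by
  induction w with
  | nil => simp
  | cons a w ih =>
    simp [ih, List.count_cons, add_mul, Finset.sum_add_distrib, add_comm]

/-- For strings `w₁, w₂` of the same length `k`, with `1 ≤ k ≤ m` and `m > 1`,
over the alphabet `Fin σ` (σ positive), the heap values coincide iff the strings
are permutations of each other. -/
theorem heap_values_eq_iff_perm
    (σ m k : ℕ) (hσ : 0 < σ) (hm : 1 < m) (hk1 : 1 ≤ k) (hkm : k ≤ m)
    (w₁ w₂ : List (Fin σ)) (h1 : w₁.length = k) (h2 : w₂.length = k) :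
    (w₁.map (fun i => m ^ (i : ℕ))).sum = (w₂.map (fun i => m ^ (i : ℕ))).sum ↔
      w₁.Perm w₂ := by
  -- the coercion `List (Fin σ) → List ℕ` elaborates to a monadic bind: unfold it to a map
  have e : ∀ w : List (Fin σ), (do let a ← w; pure (a : ℕ) : List ℕ)
      = w.map (fun a : Fin σ => (a : ℕ)) := by
    intro w
    induction w with
    | nil => rfl
    | cons a w ih => simp_all
  rw [e, e, List.map_map, List.map_map]
  constructor
  · intro h
    rw [heap_sum_count, heap_sum_count] at h
    have l : ∀ w : List (Fin σ), ∑ i, w.count i = w.length := by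
      intro w
      have := heap_sum_count σ (fun _ => 1) w
      simp only [mul_one] at this
      rw [← this]
      simp
    have := heap_counts m hm σ (fun i => w₁.count i) (fun i => w₂.count i)
      (by rw [l]; omega) (by rw [l, l]; omega) h
    exact List.perm_iff_count.mpr (fun a => congrFun this a)
  · intro h
    exact (h.map _).sum_eq
end

section
/- Let x be a string of length m and y a string of length n, both over an alphabet Σ (modeled as lists over a type α), and let ⋄ be a character that does not occur in x. Let ȳ be the reduced version of y, obtained by replacing every character of y that does not occur in x by ⋄ (i.e., ȳ[i] = y[i] if y[i] occurs in x, and ȳ[i] = ⋄ otherwise). Then the abelian occurrences of x in y coincide with the abelian occurrences of x in ȳ: Γ_{x,y} = Γ_{x,ȳ}, i.e., for every s with 0 ≤ s ≤ n − m, the multiset of characters of y[s..s+m−1] equals the multiset of characters of x if and only if the multiset of characters of ȳ[s..s+m−1] equals the multiset of characters of x. -/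
/-- Lemma 2 (alphabet reduction): replacing in the text `y` every character not
occurring in the pattern `x` by a character `d ∉ x` does not change the set of
abelian occurrences: `Γ_{x,y} = Γ_{x,ȳ}`. -/
theorem abelian_occurrences_of_reduced_text
    {α : Type*} [DecidableEq α] (x y : List α) (m n : ℕ)
    (hx : x.length = m) (hy : y.length = n)
    (d : α) (hd : d ∉ x)
    (ybar : List α) (hybar : ybar = y.map (fun c => if c ∈ x then c else d)) :
    ∀ s : ℕ, s ≤ n - m →
      ((((y.drop s).take m : List α) : Multiset α) = (x : Multiset α) ↔
        (((ybar.drop s).take m : List α) : Multiset α) = (x : Multiset α)) := by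
  intro s _
  subst hybar
  rw [← List.map_drop, ← List.map_take]
  generalize (y.drop s).take m = w
  have key : (∀ c ∈ w, c ∈ x) → w.map (fun c => if c ∈ x then c else d) = w := by
    intro h
    conv_rhs => rw [← List.map_id w]
    apply List.map_congr_left
    intro c hc
    simp [h c hc]
  rw [Multiset.coe_eq_coe, Multiset.coe_eq_coe]
  constructor
  · intro h
    rw [key (fun c hc => h.mem_iff.1 hc)]
    exact h
  · intro h
    rw [key] at h
    · exact h
    · intro c hc
      by_contra hcx
      have h1 := h.mem_iff.1 (List.mem_map_of_mem hc)
      simp only [if_neg hcx] at h1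
      exact hd h1
end
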